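/- arXiv:1011.2479 — 4 statements merged into one kernel-verified Lean document; each statement's English description precedes it below -/
import Mathlib

section
/- Let u be three times continuously differentiable on an open set U ⊆ ℂ⁴ with u_{34} ≠ 0 on U, let λ ∈ ℂ, and suppose u satisfies the general heavenly equation Φ = 0 on U. Then the Lax operators L₀ and M₀ commute on U: for every twice continuously differentiable f : U → ℂ one has L₀(M₀ f) = M₀(L₀ f). -/
/-!  Coordinates: `z : Fin 4 → ℂ` with paper indices `z¹,z²,z³,z⁴` corresponding to
`z 0, z 1, z 2, z 3`.  `pd i f` is the partial derivative ∂f/∂zⁱ. -/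

/-- Partial derivative of `f : ℂ⁴ → ℂ` in the `i`-th coordinate direction. -/
noncomputable def pd (i : Fin 4) (f : (Fin 4 → ℂ) → ℂ) : (Fin 4 → ℂ) → ℂ :=
  fun z => fderiv ℂ f z (Pi.single i 1)

/-- The left-hand side Φ = α u₁₂u₃₄ + β u₁₃u₂₄ + γ u₁₄u₂₃ of the general heavenly
equation (paper indices 1,2,3,4 ↦ 0,1,2,3). -/
noncomputable def Phi (α β γ : ℂ) (u : (Fin 4 → ℂ) → ℂ) : (Fin 4 → ℂ) → ℂ :=
  fun z => α * pd 0 (pd 1 u) z * pd 2 (pd 3 u) z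
    + β * pd 0 (pd 2 u) z * pd 1 (pd 3 u) z
    + γ * pd 0 (pd 3 u) z * pd 1 (pd 2 u) z

/-- The Lax operator `X₁ f = u₃₄ f₁ − u₁₃ f₄ + γλ(u₃₄ f₁ − u₁₄ f₃)`. -/
noncomputable def X1 (γ lam : ℂ) (u f : (Fin 4 → ℂ) → ℂ) : (Fin 4 → ℂ) → ℂ :=
  fun z => pd 2 (pd 3 u) z * pd 0 f z - pd 0 (pd 2 u) z * pd 3 f z
    + γ * lam * (pd 2 (pd 3 u) z * pd 0 f z - pd 0 (pd 3 u) z * pd 2 f z)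

/-- The Lax operator `X₂ f = u₂₃ f₄ − u₃₄ f₂ + βλ(u₃₄ f₂ − u₂₄ f₃)`. -/
noncomputable def X2 (β lam : ℂ) (u f : (Fin 4 → ℂ) → ℂ) : (Fin 4 → ℂ) → ℂ :=
  fun z => pd 1 (pd 2 u) z * pd 3 f z - pd 2 (pd 3 u) z * pd 1 f z
    + β * lam * (pd 2 (pd 3 u) z * pd 1 f z - pd 1 (pd 3 u) z * pd 2 f z)

/-- `L₀ = (1/u₃₄) X₁`. -/
noncomputable def L0 (γ lam : ℂ) (u f : (Fin 4 → ℂ) → ℂ) : (Fin 4 → ℂ) → ℂ :=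
  fun z => X1 γ lam u f z / pd 2 (pd 3 u) z

/-- `M₀ = (1/u₃₄) X₂`. -/
noncomputable def M0 (β lam : ℂ) (u f : (Fin 4 → ℂ) → ℂ) : (Fin 4 → ℂ) → ℂ :=
  fun z => X2 β lam u f z / pd 2 (pd 3 u) z

theorem pd_cd {U : Set (Fin 4 → ℂ)} (hU : IsOpen U) {n m : WithTop ℕ∞} (hnm : n + 1 ≤ m)
    {f : (Fin 4 → ℂ) → ℂ} (hf : ContDiffOn ℂ m f U) (i : Fin 4) : ContDiffOn ℂ n (pd i f) U :=
  (hf.fderiv_of_isOpen hU hnm).clm_apply contDiffOn_const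

theorem pd_symm {U : Set (Fin 4 → ℂ)} (hU : IsOpen U)
    {f : (Fin 4 → ℂ) → ℂ} (hf : ContDiffOn ℂ 2 f U) (i j : Fin 4) {z : Fin 4 → ℂ} (hz : z ∈ U) :
    pd i (pd j f) z = pd j (pd i f) z := by
  have h1 : ContDiffAt ℂ 2 f z := hf.contDiffAt (hU.mem_nhds hz)
  have hs : IsSymmSndFDerivAt ℂ f z := h1.isSymmSndFDerivAt (by simp)
  have hd : DifferentiableAt ℂ (fderiv ℂ f) z :=
    (h1.fderiv_right (m := 1) (by norm_num)).differentiableAt (by norm_num)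
  have key : ∀ a b : Fin 4, pd a (pd b f) z
      = fderiv ℂ (fderiv ℂ f) z (Pi.single a 1) (Pi.single b 1) := by
    intro a b
    have : HasFDerivAt (pd b f) _ z := hd.hasFDerivAt.clm_apply (hasFDerivAt_const (Pi.single b 1) z)
    show fderiv ℂ (pd b f) z _ = _
    rw [this.fderiv]
    simp
  rw [key, key, hs.eq]

theorem pd_congr {U : Set (Fin 4 → ℂ)} (hU : IsOpen U) {f g : (Fin 4 → ℂ) → ℂ}
    (h : ∀ z ∈ U, f z = g z) (i : Fin 4) {z : Fin 4 → ℂ} (hz : z ∈ U) : pd i f z = pd i g z := by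
  have : f =ᶠ[nhds z] g := Filter.eventually_of_mem (hU.mem_nhds hz) h
  unfold pd
  rw [this.fderiv_eq]

theorem pd_add {f g : (Fin 4 → ℂ) → ℂ} {z} (i : Fin 4) (hf : DifferentiableAt ℂ f z)
    (hg : DifferentiableAt ℂ g z) : pd i (fun x => f x + g x) z = pd i f z + pd i g z := by
  unfold pd; rw [fderiv_fun_add hf hg]; simp

theorem pd_sub {f g : (Fin 4 → ℂ) → ℂ} {z} (i : Fin 4) (hf : DifferentiableAt ℂ f z)
    (hg : DifferentiableAt ℂ g z) : pd i (fun x => f x - g x) z = pd i f z - pd i g z := by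
  unfold pd; rw [fderiv_fun_sub hf hg]; simp

theorem pd_mul {f g : (Fin 4 → ℂ) → ℂ} {z} (i : Fin 4) (hf : DifferentiableAt ℂ f z)
    (hg : DifferentiableAt ℂ g z) :
    pd i (fun x => f x * g x) z = pd i f z * g z + f z * pd i g z := by
  unfold pd; rw [fderiv_fun_mul hf hg]; simp; ring

theorem pd_cmul {f : (Fin 4 → ℂ) → ℂ} {z} (i : Fin 4) (c : ℂ) (hf : DifferentiableAt ℂ f z) :
    pd i (fun x => c * f x) z = c * pd i f z := by
  unfold pd; rw [fderiv_const_mul hf]; simp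

theorem pd_div {f g : (Fin 4 → ℂ) → ℂ} {z} (i : Fin 4) (hf : DifferentiableAt ℂ f z)
    (hg : DifferentiableAt ℂ g z) (h0 : g z ≠ 0) :
    pd i (fun x => f x / g x) z = (pd i f z - f z / g z * pd i g z) / g z := by
  have hq : DifferentiableAt ℂ (fun x => f x / g x) z := by
    simp only [div_eq_mul_inv]; exact hf.fun_mul (hg.fun_inv h0)
  have h1 := pd_mul i hq hg
  have h2 : pd i (fun x => f x / g x * g x) z = pd i f z := by
    have : (fun x => f x / g x * g x) =ᶠ[nhds z] f := by
      filter_upwards [hg.continuousAt.eventually_ne h0] with x hx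
      field_simp
    unfold pd; rw [this.fderiv_eq]
  rw [h2] at h1
  rw [h1]; field_simp; ring

/-- if `u` is C³ on an open set `U` with `u₃₄ ≠ 0` on `U` and `u` satisfies
the general heavenly equation `Φ = 0` on `U`, then the Lax operators `L₀` and `M₀`
commute on `U` on every C² function `f`. -/
theorem lax_operators_commute_on_solutions
    (U : Set (Fin 4 → ℂ)) (hU : IsOpen U)
    (u : (Fin 4 → ℂ) → ℂ) (hu : ContDiffOn ℂ 3 u U)
    (h34 : ∀ z ∈ U, pd 2 (pd 3 u) z ≠ 0)
    (α β γ lam : ℂ) (hαβγ : α + β + γ = 0)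
    (heav : ∀ z ∈ U, Phi α β γ u z = 0)
    (f : (Fin 4 → ℂ) → ℂ) (hf : ContDiffOn ℂ 2 f U) :
    ∀ z ∈ U, L0 γ lam u (M0 β lam u f) z = M0 β lam u (L0 γ lam u f) z := by
  intro z hz
  have hu2 : ContDiffOn ℂ 2 u U := hu.of_le (by norm_num)
  have du : ∀ i j, DifferentiableAt ℂ (pd i (pd j u)) z := fun i j =>
    ((pd_cd hU (n := 1) (m := 2) (by norm_num)
      (pd_cd hU (n := 2) (m := 3) (by norm_num) hu j) i).contDiffAt
        (hU.mem_nhds hz)).differentiableAt (by norm_num)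
  have df : ∀ i, DifferentiableAt ℂ (pd i f) z := fun i =>
    ((pd_cd hU (n := 1) (m := 2) (by norm_num) hf i).contDiffAt
        (hU.mem_nhds hz)).differentiableAt (by norm_num)
  have s3 : ∀ i j k, pd i (pd j (pd k u)) z = pd j (pd i (pd k u)) z := fun i j k =>
    pd_symm hU (pd_cd hU (n := 2) (m := 3) (by norm_num) hu k) i j hz
  have s3' : ∀ i j k, pd i (pd j (pd k u)) z = pd i (pd k (pd j u)) z := fun i j k =>
    pd_congr hU (fun w hw => pd_symm hU hu2 j k hw) i hz
  have hΦ : ∀ k, pd k (Phi α β γ u) z = 0 := fun k => by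
    rw [pd_congr hU (g := fun _ => 0) heav k hz]; simp [pd]
  have hΦ' : ∀ k, pd k (Phi α β γ u) z =
      α * (pd k (pd 0 (pd 1 u)) z * pd 2 (pd 3 u) z + pd 0 (pd 1 u) z * pd k (pd 2 (pd 3 u)) z)
      + β * (pd k (pd 0 (pd 2 u)) z * pd 1 (pd 3 u) z + pd 0 (pd 2 u) z * pd k (pd 1 (pd 3 u)) z)
      + γ * (pd k (pd 0 (pd 3 u)) z * pd 1 (pd 2 u) z
        + pd 0 (pd 3 u) z * pd k (pd 1 (pd 2 u)) z) := fun k => by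
    unfold Phi
    have d1 := (du 0 1).const_mul α
    have d2 := (du 0 2).const_mul β
    have d3 := (du 0 3).const_mul γ
    rw [pd_add k ((d1.fun_mul (du 2 3)).fun_add (d2.fun_mul (du 1 3))) (d3.fun_mul (du 1 2)),
      pd_add k (d1.fun_mul (du 2 3)) (d2.fun_mul (du 1 3)), pd_mul k d1 (du 2 3), pd_mul k d2 (du 1 3),
      pd_mul k d3 (du 1 2), pd_cmul k α (du 0 1), pd_cmul k β (du 0 2), pd_cmul k γ (du 0 3)]
    ring
  have h0 := h34 z hz
  have hM : ∀ k, pd k (M0 β lam u f) z =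
      ((pd k (pd 1 (pd 2 u)) z * pd 3 f z + pd 1 (pd 2 u) z * pd k (pd 3 f) z)
        - (pd k (pd 2 (pd 3 u)) z * pd 1 f z + pd 2 (pd 3 u) z * pd k (pd 1 f) z)
        + β * lam * ((pd k (pd 2 (pd 3 u)) z * pd 1 f z + pd 2 (pd 3 u) z * pd k (pd 1 f) z)
          - (pd k (pd 1 (pd 3 u)) z * pd 2 f z + pd 1 (pd 3 u) z * pd k (pd 2 f) z))
        - X2 β lam u f z / pd 2 (pd 3 u) z * pd k (pd 2 (pd 3 u)) z) / pd 2 (pd 3 u) z := by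
    intro k
    have m1 := (du 1 2).fun_mul (df 3)
    have m2 := (du 2 3).fun_mul (df 1)
    have m3 := (du 1 3).fun_mul (df 2)
    have e : pd k (X2 β lam u f) z = _ := pd_add k (m1.fun_sub m2) ((m2.fun_sub m3).const_mul (β * lam))
    have dX : DifferentiableAt ℂ (X2 β lam u f) z :=
      (m1.fun_sub m2).fun_add ((m2.fun_sub m3).const_mul (β * lam))
    unfold M0
    rw [pd_div k dX (du 2 3) h0, e, pd_sub k m1 m2, pd_cmul k (β * lam) (m2.fun_sub m3),
      pd_sub k m2 m3, pd_mul k (du 1 2) (df 3), pd_mul k (du 2 3) (df 1),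
      pd_mul k (du 1 3) (df 2)]
  have hL : ∀ k, pd k (L0 γ lam u f) z =
      ((pd k (pd 2 (pd 3 u)) z * pd 0 f z + pd 2 (pd 3 u) z * pd k (pd 0 f) z)
        - (pd k (pd 0 (pd 2 u)) z * pd 3 f z + pd 0 (pd 2 u) z * pd k (pd 3 f) z)
        + γ * lam * ((pd k (pd 2 (pd 3 u)) z * pd 0 f z + pd 2 (pd 3 u) z * pd k (pd 0 f) z)
          - (pd k (pd 0 (pd 3 u)) z * pd 2 f z + pd 0 (pd 3 u) z * pd k (pd 2 f) z))
        - X1 γ lam u f z / pd 2 (pd 3 u) z * pd k (pd 2 (pd 3 u)) z) / pd 2 (pd 3 u) z := by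
    intro k
    have m1 := (du 2 3).fun_mul (df 0)
    have m2 := (du 0 2).fun_mul (df 3)
    have m3 := (du 0 3).fun_mul (df 2)
    have e : pd k (X1 γ lam u f) z = _ := pd_add k (m1.fun_sub m2) ((m1.fun_sub m3).const_mul (γ * lam))
    have dX : DifferentiableAt ℂ (X1 γ lam u f) z :=
      (m1.fun_sub m2).fun_add ((m1.fun_sub m3).const_mul (γ * lam))
    unfold L0
    rw [pd_div k dX (du 2 3) h0, e, pd_sub k m1 m2, pd_cmul k (γ * lam) (m1.fun_sub m3),
      pd_sub k m1 m3, pd_mul k (du 2 3) (df 0), pd_mul k (du 0 2) (df 3),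
      pd_mul k (du 0 3) (df 2)]
  have P0 := heav z hz
  have P2 := (hΦ' 2).symm.trans (hΦ 2)
  have P3 := (hΦ' 3).symm.trans (hΦ 3)
  have sf : ∀ i j, pd i (pd j f) z = pd j (pd i f) z := fun i j => pd_symm hU hf i j hz
  have hα : α = -β - γ := by linear_combination hαβγ
  subst hα
  show X1 γ lam u (M0 β lam u f) z / _ = X2 β lam u (L0 γ lam u f) z / _
  congr 1
  unfold X1 X2
  simp only [hM, hL]
  unfold X1 X2
  unfold Phi at P0
  simp only [s3 1 0 2, s3 1 0 3, s3 1 0 1, s3 2 0 1, s3' 0 2 1, s3 2 0 2, s3 2 0 3, s3 2 1 2, s3 2 1 3,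
    s3 3 0 1, s3' 0 3 1, s3 3 0 2, s3' 0 3 2, s3 3 1 2, s3' 1 3 2, s3 3 0 3, s3 3 1 3, s3 3 2 3] at P2 P3
  simp only [s3 1 0 2, s3 1 0 3, s3 1 0 1, s3 2 0 1, s3' 0 2 1, s3 2 0 2, s3 2 0 3, s3 2 1 2, s3 2 1 3,
    s3 3 0 1, s3' 0 3 1, s3 3 0 2, s3' 0 3 2, s3 3 1 2, s3' 1 3 2, s3 3 0 3, s3 3 1 3, s3 3 2 3,
    sf 3 0, sf 3 1, sf 3 2, sf 2 0, sf 2 1, sf 1 0]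
  generalize pd 2 (pd 3 u) z = D at *
  linear_combination (norm := (field_simp; ring))
    (-(lam / D) * pd 3 f z) * P2 + (lam / D * pd 2 f z) * P3
    + (lam / D ^ 2 * (pd 3 f z * pd 2 (pd 2 (pd 3 u)) z - pd 2 f z * pd 2 (pd 3 (pd 3 u)) z)) * P0
end

section
/- Let β, γ ∈ ℂ and let u be twice continuously differentiable on an open set U ⊆ ℂ⁴ satisfying (β+γ)u_{12}u_{34} = βu_{13}u_{24} + γu_{14}u_{23} on U. With the coframe row vectors ρ¹ = (u_{23}u_{14}, u_{23}u_{24}, u_{34}u_{23}, u_{34}u_{24}), ρ² = (u_{13}u_{14}, u_{13}u_{24}, u_{34}u_{13}, u_{34}u_{14}), ρ³ = (u_{14}u_{13}, u_{14}u_{23}, u_{34}u_{13}, u_{34}u_{14}), ρ⁴ = (u_{24}u_{13}, u_{24}u_{23}, u_{34}u_{23}, u_{34}u_{24}), the symmetric bilinear form β(ρ²⊗ρ⁴ + ρ⁴⊗ρ²)/2 + γ(ρ¹⊗ρ³ + ρ³⊗ρ¹)/2 on ℂ⁴ equals (β+γ)·u_{34} times the symmetric form with matrix entries g_{11} = u_{12}u_{13}u_{14},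 g_{22} = u_{12}u_{23}u_{24}, g_{33} = u_{34}u_{13}u_{23}, g_{44} = u_{34}u_{14}u_{24}, 2g_{12} = (u_{13}u_{24}+u_{14}u_{23})u_{12}, 2g_{34} = (u_{13}u_{24}+u_{14}u_{23})u_{34}, 2g_{13} = (u_{12}u_{34}+u_{14}u_{23})u_{13}, 2g_{24} = (u_{12}u_{34}+u_{14}u_{23})u_{24}, 2g_{23} = (u_{12}u_{34}+u_{13}u_{24})u_{23}, 2g_{14} = (u_{12}u_{34}+u_{13}u_{24})u_{14}. (This is the coordinate form of the ASD vacuum metric identity ds² = 2(ω²ω⁴ − ω¹ω³) with the square-root prefactors cleared.) -/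
/-- Coframe row vectors ρ¹, ρ², ρ³, ρ⁴ of STATEMENT 6 (here ρ³ without the minus sign);
`rho6 u z i` is ρ^(i+1) at the point `z`. -/
noncomputable def rho6 (u : (Fin 4 → ℂ) → ℂ) (z : Fin 4 → ℂ) : Fin 4 → Fin 4 → ℂ :=
  ![![pd 1 (pd 2 u) z * pd 0 (pd 3 u) z, pd 1 (pd 2 u) z * pd 1 (pd 3 u) z,
      pd 2 (pd 3 u) z * pd 1 (pd 2 u) z, pd 2 (pd 3 u) z * pd 1 (pd 3 u) z],
    ![pd 0 (pd 2 u) z * pd 0 (pd 3 u) z, pd 0 (pd 2 u) z * pd 1 (pd 3 u) z,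
      pd 2 (pd 3 u) z * pd 0 (pd 2 u) z, pd 2 (pd 3 u) z * pd 0 (pd 3 u) z],
    ![pd 0 (pd 3 u) z * pd 0 (pd 2 u) z, pd 0 (pd 3 u) z * pd 1 (pd 2 u) z,
      pd 2 (pd 3 u) z * pd 0 (pd 2 u) z, pd 2 (pd 3 u) z * pd 0 (pd 3 u) z],
    ![pd 1 (pd 3 u) z * pd 0 (pd 2 u) z, pd 1 (pd 3 u) z * pd 1 (pd 2 u) z,
      pd 2 (pd 3 u) z * pd 1 (pd 2 u) z, pd 2 (pd 3 u) z * pd 1 (pd 3 u) z]]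

/-- The symmetric matrix `g` of the ASD vacuum metric of the general heavenly equation,
with entries `g₁₁ = u₁₂u₁₃u₁₄`, `2g₁₂ = (u₁₃u₂₄+u₁₄u₂₃)u₁₂`, etc. -/
noncomputable def gMetric (u : (Fin 4 → ℂ) → ℂ) (z : Fin 4 → ℂ) : Matrix (Fin 4) (Fin 4) ℂ :=
  !![pd 0 (pd 1 u) z * pd 0 (pd 2 u) z * pd 0 (pd 3 u) z,
       (pd 0 (pd 2 u) z * pd 1 (pd 3 u) z + pd 0 (pd 3 u) z * pd 1 (pd 2 u) z) * pd 0 (pd 1 u) z / 2,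
       (pd 0 (pd 1 u) z * pd 2 (pd 3 u) z + pd 0 (pd 3 u) z * pd 1 (pd 2 u) z) * pd 0 (pd 2 u) z / 2,
       (pd 0 (pd 1 u) z * pd 2 (pd 3 u) z + pd 0 (pd 2 u) z * pd 1 (pd 3 u) z) * pd 0 (pd 3 u) z / 2;
     (pd 0 (pd 2 u) z * pd 1 (pd 3 u) z + pd 0 (pd 3 u) z * pd 1 (pd 2 u) z) * pd 0 (pd 1 u) z / 2,
       pd 0 (pd 1 u) z * pd 1 (pd 2 u) z * pd 1 (pd 3 u) z,
       (pd 0 (pd 1 u) z * pd 2 (pd 3 u) z + pd 0 (pd 2 u) z * pd 1 (pd 3 u) z) * pd 1 (pd 2 u) z / 2,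
       (pd 0 (pd 1 u) z * pd 2 (pd 3 u) z + pd 0 (pd 3 u) z * pd 1 (pd 2 u) z) * pd 1 (pd 3 u) z / 2;
     (pd 0 (pd 1 u) z * pd 2 (pd 3 u) z + pd 0 (pd 3 u) z * pd 1 (pd 2 u) z) * pd 0 (pd 2 u) z / 2,
       (pd 0 (pd 1 u) z * pd 2 (pd 3 u) z + pd 0 (pd 2 u) z * pd 1 (pd 3 u) z) * pd 1 (pd 2 u) z / 2,
       pd 2 (pd 3 u) z * pd 0 (pd 2 u) z * pd 1 (pd 2 u) z,
       (pd 0 (pd 2 u) z * pd 1 (pd 3 u) z + pd 0 (pd 3 u) z * pd 1 (pd 2 u) z) * pd 2 (pd 3 u) z / 2;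
     (pd 0 (pd 1 u) z * pd 2 (pd 3 u) z + pd 0 (pd 2 u) z * pd 1 (pd 3 u) z) * pd 0 (pd 3 u) z / 2,
       (pd 0 (pd 1 u) z * pd 2 (pd 3 u) z + pd 0 (pd 3 u) z * pd 1 (pd 2 u) z) * pd 1 (pd 3 u) z / 2,
       (pd 0 (pd 2 u) z * pd 1 (pd 3 u) z + pd 0 (pd 3 u) z * pd 1 (pd 2 u) z) * pd 2 (pd 3 u) z / 2,
       pd 2 (pd 3 u) z * pd 0 (pd 3 u) z * pd 1 (pd 3 u) z]

/-- on solutions of `(β+γ)u₁₂u₃₄ = βu₁₃u₂₄ + γu₁₄u₂₃`, the symmetric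
bilinear form `β(ρ²⊗ρ⁴ + ρ⁴⊗ρ²)/2 + γ(ρ¹⊗ρ³ + ρ³⊗ρ¹)/2` equals `(β+γ)u₃₄` times the
symmetric form `g` (the coordinate form of the ASD vacuum metric `2(ω²ω⁴ − ω¹ω³)`). -/
theorem metric_identity
    (β γ : ℂ)
    (U : Set (Fin 4 → ℂ)) (hU : IsOpen U)
    (u : (Fin 4 → ℂ) → ℂ) (hu : ContDiffOn ℂ 2 u U)
    (heav : ∀ z ∈ U, (β + γ) * pd 0 (pd 1 u) z * pd 2 (pd 3 u) z
      = β * pd 0 (pd 2 u) z * pd 1 (pd 3 u) z + γ * pd 0 (pd 3 u) z * pd 1 (pd 2 u) z) :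
    ∀ z ∈ U, ∀ i j : Fin 4,
      β * (rho6 u z 1 i * rho6 u z 3 j + rho6 u z 3 i * rho6 u z 1 j) / 2
        + γ * (rho6 u z 0 i * rho6 u z 2 j + rho6 u z 2 i * rho6 u z 0 j) / 2
      = (β + γ) * pd 2 (pd 3 u) z * gMetric u z i j := by
  intro z hz i j
  have H := heav z hz
  unfold rho6 gMetric
  generalize pd 0 (pd 1 u) z = a at *
  generalize pd 0 (pd 2 u) z = b at *
  generalize pd 0 (pd 3 u) z = c at *
  generalize pd 1 (pd 2 u) z = d at *
  generalize pd 1 (pd 3 u) z = e at *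
  generalize pd 2 (pd 3 u) z = f at *
  fin_cases i <;> fin_cases j <;> simp
  · linear_combination (-(b*c)) * H
  · linear_combination (-((c*d+b*e)/2)) * H
  · linear_combination (-(f*b/2)) * H
  · linear_combination (-(f*c/2)) * H
  · linear_combination (-((c*d+b*e)/2)) * H
  · linear_combination (-(d*e)) * H
  · linear_combination (-(f*d/2)) * H
  · linear_combination (-(f*e/2)) * H
  · linear_combination (-(f*b/2)) * H
  · linear_combination (-(f*d/2)) * H
  · ring
  · ring
  · linear_combination (-(f*c/2)) * H
  · linear_combination (-(f*e/2)) * H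
  · ring
  · ring
end

section
/- Let α, β, γ ∈ ℂ with α + β + γ = 0, β ≠ 0, let m be a positive integer, let a₄, a₅, a₇, a₈, a₉, C ∈ ℂ with a₄ ≠ 0, a₅ ≠ 0, a₉ ≠ 0, αa₅a₈² + 2βa₄a₇a₉ ≠ 0, and define a₁ = βa₄a₅a₉²/(αa₅a₈² + 2βa₄a₇a₉), a₂ = a₅(2β²a₄a₇a₉ − αγa₅a₈²)/(4β²a₄a₉²), a₃ = (2βa₄a₇a₉ − γa₅a₈²)/(4βa₄a₅), a₆ = 0, a₁₀ = −αa₅a₈/(βa₉). Define Q(z) = a₁(z¹)^{2m} + a₂(z²)^{2m} + a₃(z³)^{2m} + a₄(z⁴)^{2m} + a₅(z¹)^m(z²)^m + a₇(z²)^m(z³)^m + a₈(z³)^m(z⁴)^m + a₉(z¹)^m(z³)^m + a₁₀(z²)^m(z⁴)^m + C. If u : U → ℂ is twice continuously differentiable on an open set U ⊆ ℂ⁴, u(z) ≠ 0 on U, and u(z)^{2m} = Q(z) for all z ∈ U, then u satisfies the general heavenly equation α u_{12}u_{34} + β u_{13}u_{24} + γ u_{14}u_{23} = 0 on U. -/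
/-- The polynomial `Q(z) = a₁(z¹)^{2m} + a₂(z²)^{2m} + a₃(z³)^{2m} + a₄(z⁴)^{2m}
+ a₅(z¹)^m(z²)^m + a₆(z¹)^m(z⁴)^m + a₇(z²)^m(z³)^m + a₈(z³)^m(z⁴)^m
+ a₉(z¹)^m(z³)^m + a₁₀(z²)^m(z⁴)^m + C`. -/
noncomputable def Qpoly (m : ℕ) (a1 a2 a3 a4 a5 a6 a7 a8 a9 a10 C : ℂ)
    (z : Fin 4 → ℂ) : ℂ :=
  a1 * (z 0) ^ (2 * m) + a2 * (z 1) ^ (2 * m) + a3 * (z 2) ^ (2 * m) + a4 * (z 3) ^ (2 * m)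
    + a5 * (z 0) ^ m * (z 1) ^ m + a6 * (z 0) ^ m * (z 3) ^ m
    + a7 * (z 1) ^ m * (z 2) ^ m + a8 * (z 2) ^ m * (z 3) ^ m
    + a9 * (z 0) ^ m * (z 2) ^ m + a10 * (z 1) ^ m * (z 3) ^ m + C

def HP (i : Fin 4) (f : (Fin 4 → ℂ) → ℂ) (z : Fin 4 → ℂ) (a : ℂ) : Prop :=
  DifferentiableAt ℂ f z ∧ pd i f z = a

theorem HP.add {i f g z a b} (hf : HP i f z a) (hg : HP i g z b) :
    HP i (fun z => f z + g z) z (a + b) := by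
  refine ⟨hf.1.fun_add hg.1, ?_⟩
  have h1 := hf.2
  have h2 := hg.2
  unfold pd at *
  rw [fderiv_fun_add hf.1 hg.1]
  simp [h1, h2]

theorem HP.mul {i f g z a b} (hf : HP i f z a) (hg : HP i g z b) :
    HP i (fun z => f z * g z) z (a * g z + f z * b) := by
  refine ⟨hf.1.fun_mul hg.1, ?_⟩
  have h1 := hf.2
  have h2 := hg.2
  unfold pd at *
  rw [fderiv_fun_mul hf.1 hg.1]
  simp [h1, h2]
  ring

theorem HP.pow {i f z a} (hf : HP i f z a) (n : ℕ) :
    HP i (fun z => f z ^ n) z (n * f z ^ (n - 1) * a) := by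
  refine ⟨hf.1.fun_pow n, ?_⟩
  have h1 := hf.2
  unfold pd at *
  rw [fderiv_fun_pow n hf.1]
  simp [h1]

theorem HP.const (i c z) : HP i (fun _ => c) z 0 := by
  refine ⟨differentiableAt_const c, ?_⟩
  simp [pd]

theorem HP.coord (i j z) : HP i (fun z => z j) z (if j = i then 1 else 0) := by
  refine ⟨by fun_prop, ?_⟩
  have : HasFDerivAt (fun z : Fin 4 → ℂ => z j)
    (ContinuousLinearMap.proj (R := ℂ) (φ := fun _ : Fin 4 => ℂ) j) z := hasFDerivAt_apply j z
  simp [pd, this.fderiv, Pi.single_apply]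

theorem HP.cg {i f z a b} (hf : HP i f z a) (h : a = b) : HP i f z b := h ▸ hf

theorem HP.congr {i f g z a} {U : Set (Fin 4 → ℂ)} (hU : IsOpen U) (hz : z ∈ U)
    (h : ∀ z ∈ U, f z = g z) (hf : HP i f z a) : HP i g z a := by
  have e : g =ᶠ[nhds z] f := by
    filter_upwards [hU.mem_nhds hz] with y hy using (h y hy).symm
  refine ⟨hf.1.congr_of_eventuallyEq e, ?_⟩
  rw [← hf.2]
  unfold pd
  rw [e.fderiv_eq]

theorem HP.uniq {i f z a b} (h : HP i f z a) (h' : HP i f z b) : a = b := h.2.symm.trans h'.2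

/-- linear forms -/
def Lf (m : ℕ) (b : Fin 4 → ℂ) (z : Fin 4 → ℂ) : ℂ :=
  b 0 * z 0 ^ m + b 1 * z 1 ^ m + b 2 * z 2 ^ m + b 3 * z 3 ^ m

theorem HP.W (i j : Fin 4) (m : ℕ) (z : Fin 4 → ℂ) : HP i (fun z => z j ^ m) z (if j = i then m * z i ^ (m-1) else 0) := by
  refine ((HP.coord i j z).pow m).cg ?_
  split_ifs with h
  · subst h; ring
  · ring

theorem HP.Lf (i : Fin 4) (m : ℕ) (b z : Fin 4 → ℂ) : HP i (Lf m b) z (m * z i ^ (m-1) * b i) := by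
  refine ((((((HP.const i (b 0) z).mul (HP.W i 0 m z)).add
    ((HP.const i (b 1) z).mul (HP.W i 1 m z))).add
    ((HP.const i (b 2) z).mul (HP.W i 2 m z))).add
    ((HP.const i (b 3) z).mul (HP.W i 3 m z)))).cg ?_
  fin_cases i <;> simp <;> ring

def Hm (a1 a2 a3 a4 a5 a7 a8 a9 a10 : ℂ) : Fin 4 → Fin 4 → ℂ :=
  ![![2*a1,a5,a9,0],![a5,2*a2,a7,a10],![a9,a7,2*a3,a8],![0,a10,a8,2*a4]]

theorem HP.Q (i : Fin 4) (m : ℕ) (z : Fin 4 → ℂ) (a1 a2 a3 a4 a5 a7 a8 a9 a10 C : ℂ) :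
    HP i (Qpoly m a1 a2 a3 a4 a5 0 a7 a8 a9 a10 C) z
      (m * z i ^ (m-1) * _root_.Lf m (Hm a1 a2 a3 a4 a5 a7 a8 a9 a10 i) z) := by
  have e : Qpoly m a1 a2 a3 a4 a5 0 a7 a8 a9 a10 C = fun z =>
      z 0 ^ m * _root_.Lf m ![a1, a5, a9, 0] z + z 1 ^ m * _root_.Lf m ![0, a2, a7, a10] z
       + z 2 ^ m * _root_.Lf m ![0, 0, a3, a8] z + z 3 ^ m * _root_.Lf m ![0, 0, 0, a4] z + C := by
    funext z
    simp [Qpoly, _root_.Lf]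
    ring
  rw [e]
  refine ((((((HP.W i 0 m z).mul (HP.Lf i m _ z)).add
    ((HP.W i 1 m z).mul (HP.Lf i m _ z))).add
    ((HP.W i 2 m z).mul (HP.Lf i m _ z))).add
    ((HP.W i 3 m z).mul (HP.Lf i m _ z))).add (HP.const i C z)).cg ?_
  fin_cases i <;> simp [_root_.Lf, Hm] <;> ring

theorem key (m : ℕ) (hm : 0 < m) (a1 a2 a3 a4 a5 a7 a8 a9 a10 C : ℂ)
    (U : Set (Fin 4 → ℂ)) (hU : IsOpen U)
    (u : (Fin 4 → ℂ) → ℂ) (hu : ContDiffOn ℂ 2 u U)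
    (hsol : ∀ z ∈ U, u z ^ (2 * m) = Qpoly m a1 a2 a3 a4 a5 0 a7 a8 a9 a10 C z)
    (z) (hz : z ∈ U) (i j : Fin 4) (hij : i ≠ j) :
    (2 * m : ℂ) ^ 2 * u z ^ (2 * m - 1) * u z ^ (2 * m) * pd i (pd j u) z =
      (m * z i ^ (m-1)) * (m * z j ^ (m-1)) *
      (2 * m * u z ^ (2 * m) * Hm a1 a2 a3 a4 a5 a7 a8 a9 a10 j i
        - (2 * m - 1) * Lf m (Hm a1 a2 a3 a4 a5 a7 a8 a9 a10 i) z
           * Lf m (Hm a1 a2 a3 a4 a5 a7 a8 a9 a10 j) z) := by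
  have hd : ∀ y ∈ U, ∀ k, HP k u y (pd k u y) := fun y hy k =>
    ⟨(hu.differentiableOn (by norm_num)).differentiableAt (hU.mem_nhds hy), rfl⟩
  have h1 : ∀ k, ∀ y ∈ U, ((2 * m : ℕ) : ℂ) * u y ^ (2 * m - 1) * pd k u y =
      m * y k ^ (m-1) * Lf m (Hm a1 a2 a3 a4 a5 a7 a8 a9 a10 k) y := fun k y hy =>
    (((hd y hy k).pow (2*m)).congr hU hy hsol).uniq (HP.Q k m y ..)
  have hdd : HP i (pd j u) z (pd i (pd j u) z) := by
    refine ⟨?_, rfl⟩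
    have : ContDiffOn ℂ 1 (fderiv ℂ u) U := hu.fderiv_of_isOpen hU (by norm_num)
    have h2 := (this.differentiableOn (by norm_num)).differentiableAt (hU.mem_nhds hz)
    unfold pd
    exact h2.clm_apply (differentiableAt_const _)
  have L := (((HP.const i ((2 * m : ℕ) : ℂ) z).mul ((hd z hz i).pow (2*m-1))).mul hdd)
  have R := (((HP.const i (m:ℂ) z).mul (HP.W i j (m-1) z)).mul
    (HP.Lf i m (Hm a1 a2 a3 a4 a5 a7 a8 a9 a10 j) z))
  have E := (L.congr hU hz (h1 j)).uniq R
  have hi := h1 i z hz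
  have hj := h1 j z hz
  rw [if_neg hij.symm] at E
  obtain ⟨k, hk⟩ : ∃ k, 2 * m = k + 2 := ⟨2*m-2, by omega⟩
  have hkc : (2 * m : ℂ) = k + 2 := by exact_mod_cast hk
  rw [hk] at E hi hj ⊢
  rw [hkc]
  simp only [show k + 2 - 1 = k + 1 by omega, show k + 1 - 1 = k by omega] at E hi hj ⊢
  push_cast at E hi hj ⊢
  generalize Lf m (Hm a1 a2 a3 a4 a5 a7 a8 a9 a10 i) z = Li at *
  generalize Lf m (Hm a1 a2 a3 a4 a5 a7 a8 a9 a10 j) z = Lj at *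
  generalize (m * z i ^ (m-1) : ℂ) = si at *
  linear_combination ((k:ℂ) + 2) * u z ^ (k+2) * E - (k+1) * (k + 2) * u z ^ (k+1) * pd j u z * hi
    - (k+1) * si * Li * hj

theorem alg (α β γ : ℂ) (hαβγ : α + β + γ = 0) (hβ : β ≠ 0)
    (a1 a2 a3 a4 a5 a7 a8 a9 a10 : ℂ)
    (ha4 : a4 ≠ 0) (ha5 : a5 ≠ 0) (ha9 : a9 ≠ 0)
    (hden : α * a5 * a8 ^ 2 + 2 * β * a4 * a7 * a9 ≠ 0)
    (ha1 : a1 = β * a4 * a5 * a9 ^ 2 / (α * a5 * a8 ^ 2 + 2 * β * a4 * a7 * a9))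
    (ha2 : a2 = a5 * (2 * β ^ 2 * a4 * a7 * a9 - α * γ * a5 * a8 ^ 2)
      / (4 * β ^ 2 * a4 * a9 ^ 2))
    (ha3 : a3 = (2 * β * a4 * a7 * a9 - γ * a5 * a8 ^ 2) / (4 * β * a4 * a5))
    (ha10 : a10 = -(α * a5 * a8) / (β * a9)) (x y z w L0 L1 L2 L3 : ℂ)
    (h0 : L0 = 2 * a1 * x + a5 * y + a9 * z)
    (h1 : L1 = a5 * x + 2 * a2 * y + a7 * z + a10 * w)
    (h2 : L2 = a9 * x + a7 * y + 2 * a3 * z + a8 * w)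
    (h3 : L3 = a10 * y + a8 * z + 2 * a4 * w) :
    α * (a5 * L2 * L3 + a8 * L0 * L1) + β * (a9 * L1 * L3 + a10 * L0 * L2)
      + γ * a7 * L0 * L3 = 0 := by
  have hγ : γ = -α-β := by linear_combination hαβγ
  subst hγ
  obtain ⟨D, hD⟩ : ∃ D, D = α * a5 * a8 ^ 2 + 2 * β * a4 * a7 * a9 := ⟨_, rfl⟩
  rw [← hD] at hden ha1
  have ha7 : a7 = (D - α * a5 * a8 ^ 2) / (2 * β * a4 * a9) := by
    rw [hD]; field_simp; ring
  clear hD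
  subst ha7
  subst ha1 ha2 ha3 ha10 h0 h1 h2 h3
  field_simp
  ring

/-- the second family (\ref{sol2}) of coefficients yields algebraic
solutions `u^{2m} = Q(z)` of the general heavenly equation (here `a₆ = 0`). -/
theorem algebraic_solution_family_two
    (α β γ : ℂ) (hαβγ : α + β + γ = 0) (hβ : β ≠ 0)
    (m : ℕ) (hm : 0 < m)
    (a1 a2 a3 a4 a5 a7 a8 a9 a10 C : ℂ)
    (ha4 : a4 ≠ 0) (ha5 : a5 ≠ 0) (ha9 : a9 ≠ 0)
    (hden : α * a5 * a8 ^ 2 + 2 * β * a4 * a7 * a9 ≠ 0)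
    (ha1 : a1 = β * a4 * a5 * a9 ^ 2 / (α * a5 * a8 ^ 2 + 2 * β * a4 * a7 * a9))
    (ha2 : a2 = a5 * (2 * β ^ 2 * a4 * a7 * a9 - α * γ * a5 * a8 ^ 2)
      / (4 * β ^ 2 * a4 * a9 ^ 2))
    (ha3 : a3 = (2 * β * a4 * a7 * a9 - γ * a5 * a8 ^ 2) / (4 * β * a4 * a5))
    (ha10 : a10 = -(α * a5 * a8) / (β * a9))
    (U : Set (Fin 4 → ℂ)) (hU : IsOpen U)
    (u : (Fin 4 → ℂ) → ℂ) (hu : ContDiffOn ℂ 2 u U)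
    (hne : ∀ z ∈ U, u z ≠ 0)
    (hsol : ∀ z ∈ U, u z ^ (2 * m) = Qpoly m a1 a2 a3 a4 a5 0 a7 a8 a9 a10 C z) :
    ∀ z ∈ U,
      α * pd 0 (pd 1 u) z * pd 2 (pd 3 u) z
        + β * pd 0 (pd 2 u) z * pd 1 (pd 3 u) z
        + γ * pd 0 (pd 3 u) z * pd 1 (pd 2 u) z = 0 := by
  intro z hz
  have K := key m hm a1 a2 a3 a4 a5 a7 a8 a9 a10 C U hU u hu hsol z hz
  have A := alg α β γ hαβγ hβ a1 a2 a3 a4 a5 a7 a8 a9 a10 ha4 ha5 ha9 hden ha1 ha2 ha3 ha10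
    (z 0 ^ m) (z 1 ^ m) (z 2 ^ m) (z 3 ^ m)
    (Lf m (Hm a1 a2 a3 a4 a5 a7 a8 a9 a10 0) z) (Lf m (Hm a1 a2 a3 a4 a5 a7 a8 a9 a10 1) z)
    (Lf m (Hm a1 a2 a3 a4 a5 a7 a8 a9 a10 2) z) (Lf m (Hm a1 a2 a3 a4 a5 a7 a8 a9 a10 3) z)
    (by simp [Lf, Hm]) (by simp [Lf, Hm]) (by simp [Lf, Hm]) (by simp [Lf, Hm])
  have B : α * a5 * a8 + β * a9 * a10 = 0 := by
    rw [ha10]; field_simp; ring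
  have k01 := K 0 1 (by decide)
  have k23 := K 2 3 (by decide)
  have k02 := K 0 2 (by decide)
  have k13 := K 1 3 (by decide)
  have k03 := K 0 3 (by decide)
  have k12 := K 1 2 (by decide)
  have hK : (2 * m : ℂ) ^ 2 * u z ^ (2 * m - 1) * u z ^ (2 * m) ≠ 0 := by
    have h1 := hne z hz
    have h2 : (m : ℂ) ≠ 0 := by exact_mod_cast hm.ne'
    simp [h1, h2]
  rw [show Hm a1 a2 a3 a4 a5 a7 a8 a9 a10 1 0 = a5 from rfl] at k01
  rw [show Hm a1 a2 a3 a4 a5 a7 a8 a9 a10 3 2 = a8 from rfl] at k23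
  rw [show Hm a1 a2 a3 a4 a5 a7 a8 a9 a10 2 0 = a9 from rfl] at k02
  rw [show Hm a1 a2 a3 a4 a5 a7 a8 a9 a10 3 1 = a10 from rfl] at k13
  rw [show Hm a1 a2 a3 a4 a5 a7 a8 a9 a10 3 0 = 0 from rfl] at k03
  rw [show Hm a1 a2 a3 a4 a5 a7 a8 a9 a10 2 1 = a7 from rfl] at k12
  clear K hsol ha1 ha2 ha3 ha10 hden
  generalize (2 * m : ℂ) ^ 2 * u z ^ (2 * m - 1) * u z ^ (2 * m) = κ at *
  generalize Lf m (Hm a1 a2 a3 a4 a5 a7 a8 a9 a10 0) z = L0 at *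
  generalize Lf m (Hm a1 a2 a3 a4 a5 a7 a8 a9 a10 1) z = L1 at *
  generalize Lf m (Hm a1 a2 a3 a4 a5 a7 a8 a9 a10 2) z = L2 at *
  generalize Lf m (Hm a1 a2 a3 a4 a5 a7 a8 a9 a10 3) z = L3 at *
  generalize (m * z 0 ^ (m-1) : ℂ) = s0 at *
  generalize (m * z 1 ^ (m-1) : ℂ) = s1 at *
  generalize (m * z 2 ^ (m-1) : ℂ) = s2 at *
  generalize (m * z 3 ^ (m-1) : ℂ) = s3 at *
  generalize u z ^ (2 * m) = P at *
  generalize (2 * m : ℂ) = n at *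
  have hγ : γ = -α-β := by linear_combination hαβγ
  apply mul_left_cancel₀ (pow_ne_zero 2 hK)
  generalize pd 0 (pd 1 u) z = u01 at *
  generalize pd 2 (pd 3 u) z = u23 at *
  generalize pd 0 (pd 2 u) z = u02 at *
  generalize pd 1 (pd 3 u) z = u13 at *
  generalize pd 0 (pd 3 u) z = u03 at *
  generalize pd 1 (pd 2 u) z = u12 at *
  have e : κ ^ 2 * (α * u01 * u23 + β * u02 * u13 + γ * u03 * u12) =
    α * (κ * u01) * (κ * u23) + β * (κ * u02) * (κ * u13) + γ * (κ * u03) * (κ * u12) := by ring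
  rw [e, k01, k23, k02, k13, k03, k12]
  linear_combination s0 * s1 * s2 * s3 * (n^2 * P^2 * B - n * (n-1) * P * A
    + (n-1)^2 * L0 * L1 * L2 * L3 * hαβγ)
end

section
/- Let α, β, γ ∈ ℂ with α + β + γ = 0. Let P : U → ℂ be twice continuously differentiable on an open set U ⊆ ℂ⁴ satisfying both the general heavenly equation αP_{12}P_{34} + βP_{13}P_{24} + γP_{14}P_{23} = 0 and the differential constraint α(P₁P₂P_{34} + P₃P₄P_{12}) + β(P₁P₃P_{24} + P₂P₄P_{13}) + γ(P₁P₄P_{23} + P₂P₃P_{14}) = 0 on U. Then for every twice continuously differentiable g : ℂ → ℂ (in the complex-differentiable sense), the function u = g ∘ P satisfies the general heavenly equation α u_{12}u_{34} + β u_{13}u_{24} + γ u_{14}u_{23} = 0 on U. -/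
theorem pd_pd_comp (U : Set (Fin 4 → ℂ)) (hU : IsOpen U)
    (P : (Fin 4 → ℂ) → ℂ) (hP : ContDiffOn ℂ 2 P U)
    (g : ℂ → ℂ) (hg : ContDiff ℂ 2 g) (z : Fin 4 → ℂ) (hz : z ∈ U) (i j : Fin 4) :
    pd i (pd j (fun w => g (P w))) z
      = deriv g (P z) * pd i (pd j P) z + deriv (deriv g) (P z) * pd i P z * pd j P z := by
  have hPd : ∀ w ∈ U, DifferentiableAt ℂ P w := fun w hw =>
    (hP.contDiffAt (hU.mem_nhds hw)).differentiableAt (by norm_num)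
  have hgd : Differentiable ℂ g := hg.differentiable (by norm_num)
  have hg1 : Differentiable ℂ (deriv g) := by
    have h : ContDiff ℂ (1 + 1) g := by simpa [one_add_one_eq_two] using hg
    exact (contDiff_succ_iff_deriv.1 h).2.2.differentiable (by norm_num)
  have hev : pd j (fun w => g (P w)) =ᶠ[nhds z] fun w => deriv g (P w) * pd j P w := by
    filter_upwards [hU.mem_nhds hz] with w hw
    have h := ((hgd (P w)).hasDerivAt.comp_hasFDerivAt w (hPd w hw).hasFDerivAt).fderiv
    have h' : fderiv ℂ (fun w => g (P w)) w = deriv g (P w) • fderiv ℂ P w := h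
    simp [pd, h']
  have hD : DifferentiableAt ℂ (pd j P) z := by
    have h : DifferentiableAt ℂ (fderiv ℂ P) z :=
      ((hP.contDiffAt (hU.mem_nhds hz)).fderiv_right (m := 1)
        (by norm_num [one_add_one_eq_two])).differentiableAt (by norm_num)
    exact h.clm_apply (differentiableAt_const _)
  have h1 : HasFDerivAt (fun w => deriv g (P w)) (deriv (deriv g) (P z) • fderiv ℂ P z) z :=
    (hg1 (P z)).hasDerivAt.comp_hasFDerivAt z (hPd z hz).hasFDerivAt
  have h2 := (h1.mul hD.hasFDerivAt).fderiv
  have h3 : fderiv ℂ (fun w => deriv g (P w) * pd j P w) z = _ := h2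
  have h4 : pd i (pd j (fun w => g (P w))) z
      = fderiv ℂ (fun w => deriv g (P w) * pd j P w) z (Pi.single i 1) := by
    rw [pd, hev.fderiv_eq]
  have h5 : pd i (pd j P) z = fderiv ℂ (pd j P) z (Pi.single i 1) := rfl
  have h6 : pd i P z = fderiv ℂ P z (Pi.single i 1) := rfl
  rw [h4, h3, h5, h6]
  simp only [ContinuousLinearMap.add_apply, ContinuousLinearMap.smul_apply, smul_eq_mul]
  ring

/-- Theorem 2 of the paper, local form: if `P` satisfies the general
heavenly equation and the differential constraint (\ref{difcon}), then `u = g ∘ P`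
satisfies the general heavenly equation for every C² holomorphic `g : ℂ → ℂ`. -/
theorem functionally_invariant_solution
    (α β γ : ℂ) (hαβγ : α + β + γ = 0)
    (U : Set (Fin 4 → ℂ)) (hU : IsOpen U)
    (P : (Fin 4 → ℂ) → ℂ) (hP : ContDiffOn ℂ 2 P U)
    (heav : ∀ z ∈ U,
      α * pd 0 (pd 1 P) z * pd 2 (pd 3 P) z
        + β * pd 0 (pd 2 P) z * pd 1 (pd 3 P) z
        + γ * pd 0 (pd 3 P) z * pd 1 (pd 2 P) z = 0)
    (hcon : ∀ z ∈ U,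
      α * (pd 0 P z * pd 1 P z * pd 2 (pd 3 P) z
            + pd 2 P z * pd 3 P z * pd 0 (pd 1 P) z)
        + β * (pd 0 P z * pd 2 P z * pd 1 (pd 3 P) z
            + pd 1 P z * pd 3 P z * pd 0 (pd 2 P) z)
        + γ * (pd 0 P z * pd 3 P z * pd 1 (pd 2 P) z
            + pd 1 P z * pd 2 P z * pd 0 (pd 3 P) z) = 0)
    (g : ℂ → ℂ) (hg : ContDiff ℂ 2 g) :
    ∀ z ∈ U,
      α * pd 0 (pd 1 (fun w => g (P w))) z * pd 2 (pd 3 (fun w => g (P w))) z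
        + β * pd 0 (pd 2 (fun w => g (P w))) z * pd 1 (pd 3 (fun w => g (P w))) z
        + γ * pd 0 (pd 3 (fun w => g (P w))) z * pd 1 (pd 2 (fun w => g (P w))) z = 0 := by
  intro z hz
  simp only [pd_pd_comp U hU P hP g hg z hz]
  linear_combination (deriv g (P z)) ^ 2 * heav z hz
    + deriv g (P z) * deriv (deriv g) (P z) * hcon z hz
    + (deriv (deriv g) (P z)) ^ 2 * (pd 0 P z * pd 1 P z * pd 2 P z * pd 3 P z) * hαβγ
end
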